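/- Consider the Bell scenario with measurements X = {a, a', b, b'}, contexts C_1 = {a,b}, C_2 = {a,b'}, C_3 = {a',b}, C_4 = {a',b'}, and outcomes O = {0,1}. Work in the free abelian groups F_ℤ(O^U) of finitely supported ℤ-valued functions on the function sets O^U, with restriction maps given by pushforward along function restriction (the homomorphism sending a generator s : U → O to the generator s|_V). Let s_1 ∈ O^{C_1} be the section (a ↦ 0, b ↦ 0); let s_6, s_7, s_8 ∈ O^{C_2} be (a↦0, b'↦1), (a↦1, b'↦0), (a↦1, b'↦1) respectively; let s_{11} ∈ O^{C_3} be (a'↦1, b↦0); and let s_{15} ∈ O^{C_4} be (a'↦1, b'↦0). Then the family r_1 = 1·s_1, r_2 = 1·s_6 + 1·s_7 − 1·s_8, r_3 = 1·s_{11}, r_4 = 1·s_{15} is compatible: for all i, j ∈ {1,2,3,4}, the restrictions of r_i and r_j to F_ℤ(O^{C_i ∩ C_j}) are equal. (All the generators used lie in the support of the Hardy model, so this family witnesses that the cohomological obstruction γ(s_1) vanishes even though the Hardy model is non-local: a false positive.) -/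

import Mathlib

/-- The measurements of the Bell scenario: `a, a', b, b'`. -/
inductive Meas : Type
  | a | a' | b | b'
deriving DecidableEq

/-- The four contexts `C_1 = {a,b}`, `C_2 = {a,b'}`, `C_3 = {a',b}`, `C_4 = {a',b'}`. -/
def Ctx (i : Fin 4) : Set Meas :=
  match i with
  | ⟨0, _⟩ => {Meas.a, Meas.b}
  | ⟨1, _⟩ => {Meas.a, Meas.b'}
  | ⟨2, _⟩ => {Meas.a', Meas.b}
  | ⟨3, _⟩ => {Meas.a', Meas.b'}

/-- Restriction of a section `s : U → O` along an inclusion `V ⊆ U`. -/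
def resFun {X O : Type*} {U V : Set X} (h : V ⊆ U) (s : U → O) : V → O :=
  fun v => s (Set.inclusion h v)

/-- `s_1 = (a ↦ 0, b ↦ 0)`. -/
def hardyS1 : Ctx 0 → Fin 2 := fun _ => 0

/-- `s_6 = (a ↦ 0, b' ↦ 1)`. -/
def hardyS6 : Ctx 1 → Fin 2 := fun x => if x.1 = Meas.a then 0 else 1

/-- `s_7 = (a ↦ 1, b' ↦ 0)`. -/
def hardyS7 : Ctx 1 → Fin 2 := fun x => if x.1 = Meas.a then 1 else 0

/-- `s_8 = (a ↦ 1, b' ↦ 1)`. -/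
def hardyS8 : Ctx 1 → Fin 2 := fun _ => 1

/-- `s_11 = (a' ↦ 1, b ↦ 0)`. -/
def hardyS11 : Ctx 2 → Fin 2 := fun x => if x.1 = Meas.a' then 1 else 0

/-- `s_15 = (a' ↦ 1, b' ↦ 0)`. -/
def hardyS15 : Ctx 3 → Fin 2 := fun x => if x.1 = Meas.a' then 1 else 0

/-- The family `r_1 = 1·s_1`, `r_2 = 1·s_6 + 1·s_7 − 1·s_8`, `r_3 = 1·s_11`, `r_4 = 1·s_15`
of elements of the free abelian groups `F_ℤ(O^{C_i})`. -/
noncomputable def hardyR (i : Fin 4) : (Ctx i → Fin 2) →₀ ℤ :=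
  match i with
  | ⟨0, _⟩ => Finsupp.single hardyS1 (1 : ℤ)
  | ⟨1, _⟩ => (Finsupp.single hardyS6 (1 : ℤ) + Finsupp.single hardyS7 (1 : ℤ) -
      Finsupp.single hardyS8 (1 : ℤ) : (Ctx 1 → Fin 2) →₀ ℤ)
  | ⟨2, _⟩ => Finsupp.single hardyS11 (1 : ℤ)
  | ⟨3, _⟩ => Finsupp.single hardyS15 (1 : ℤ)

theorem Ctx_zero : Ctx 0 = {Meas.a, Meas.b} := rfl

theorem Ctx_one : Ctx 1 = {Meas.a, Meas.b'} := rfl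

theorem Ctx_two : Ctx 2 = {Meas.a', Meas.b} := rfl

theorem Ctx_three : Ctx 3 = {Meas.a', Meas.b'} := rfl

theorem hardyR_zero : hardyR 0 = Finsupp.single hardyS1 1 := rfl

theorem hardyR_two : hardyR 2 = Finsupp.single hardyS11 1 := rfl

theorem hardyR_three : hardyR 3 = Finsupp.single hardyS15 1 := rfl

theorem mapDomain_hardyR_one {Y : Type*} (f : (Ctx 1 → Fin 2) → Y) :
    Finsupp.mapDomain f (hardyR 1) =
      Finsupp.single (f hardyS6) 1 + Finsupp.single (f hardyS7) 1 -
        Finsupp.single (f hardyS8) 1 := by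
  have h : hardyR 1 = Finsupp.single hardyS6 1 + Finsupp.single hardyS7 1 -
      Finsupp.single hardyS8 1 := rfl
  simp only [h, sub_eq_add_neg, ← Finsupp.single_neg, Finsupp.mapDomain_add,
    Finsupp.mapDomain_single]

theorem mapDomain_hardyR_one_of_eq_right {Y : Type*} {f : (Ctx 1 → Fin 2) → Y}
    (h : f hardyS7 = f hardyS8) :
    Finsupp.mapDomain f (hardyR 1) = Finsupp.single (f hardyS6) 1 := by
  rw [mapDomain_hardyR_one, h, add_sub_cancel_right]

theorem mapDomain_hardyR_one_of_eq_left {Y : Type*} {f : (Ctx 1 → Fin 2) → Y}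
    (h : f hardyS6 = f hardyS8) :
    Finsupp.mapDomain f (hardyR 1) = Finsupp.single (f hardyS7) 1 := by
  rw [mapDomain_hardyR_one, h, add_sub_cancel_left]

theorem hardyR_compatible_of_lt {i j : Fin 4} (hij : i < j) :
    Finsupp.mapDomain (resFun (Set.inter_subset_left : Ctx i ∩ Ctx j ⊆ Ctx i)) (hardyR i) =
    Finsupp.mapDomain (resFun (Set.inter_subset_right : Ctx i ∩ Ctx j ⊆ Ctx j)) (hardyR j) := by
  have h01 : resFun (Set.inter_subset_right : Ctx 0 ∩ Ctx 1 ⊆ Ctx 1) hardyS7 =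
      resFun Set.inter_subset_right hardyS8 := by
    funext ⟨x, hx⟩
    revert hx
    cases x <;> simp [resFun, hardyS7, hardyS8, Ctx_zero, Ctx_one]
  have h12 : resFun (Set.inter_subset_left : Ctx 1 ∩ Ctx 2 ⊆ Ctx 1) hardyS7 =
      resFun Set.inter_subset_left hardyS8 := by
    funext ⟨x, hx⟩
    revert hx
    cases x <;> simp [resFun, hardyS7, hardyS8, Ctx_one, Ctx_two]
  have h13 : resFun (Set.inter_subset_left : Ctx 1 ∩ Ctx 3 ⊆ Ctx 1) hardyS6 =
      resFun Set.inter_subset_left hardyS8 := by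
    funext ⟨x, hx⟩
    revert hx
    cases x <;> simp [resFun, hardyS6, hardyS8, Ctx_one, Ctx_three]
  fin_cases i <;> fin_cases j <;> first | exact absurd hij (by decide) | skip
  all_goals
    simp only [Fin.zero_eta, Fin.mk_one, Fin.reduceFinMk]
    simp only [hardyR_zero, hardyR_two, hardyR_three, mapDomain_hardyR_one_of_eq_right h01,
      mapDomain_hardyR_one_of_eq_right h12, mapDomain_hardyR_one_of_eq_left h13,
      Finsupp.mapDomain_single]
    refine congrArg (Finsupp.single · 1) (funext fun ⟨x, hx⟩ ↦ ?_)
    revert hx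
    cases x <;> simp [Ctx_zero, Ctx_one, Ctx_two, Ctx_three, resFun, hardyS1, hardyS6, hardyS7,
      hardyS11, hardyS15]

theorem mapDomain_resFun_eq_of_eq {X O : Type*} {U V W W' : Set X} (e : W = W')
    {hU : W ⊆ U} {hV : W ⊆ V} {hU' : W' ⊆ U} {hV' : W' ⊆ V}
    {r : (U → O) →₀ ℤ} {s : (V → O) →₀ ℤ}
    (h : Finsupp.mapDomain (resFun hU) r = Finsupp.mapDomain (resFun hV) s) :
    Finsupp.mapDomain (resFun hU') r = Finsupp.mapDomain (resFun hV') s := by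
  subst e
  exact h

/-- In the Bell scenario with the four contexts above, the family
`r_1 = 1·s_1`, `r_2 = 1·s_6 + 1·s_7 − 1·s_8`, `r_3 = 1·s_11`, `r_4 = 1·s_15` is compatible:
for all `i, j`, the restrictions (pushforwards along function restriction) of `r_i` and `r_j`
to `F_ℤ(O^{C_i ∩ C_j})` agree. (This family of `ℤ`-linear combinations of sections in the
support of the Hardy model witnesses that the cohomological obstruction `γ(s_1)` vanishes,
even though the Hardy model is non-local: a false positive.) -/
theorem hardy_false_positive :
    ∀ i j : Fin 4,
      Finsupp.mapDomain (resFun (Set.inter_subset_left : Ctx i ∩ Ctx j ⊆ Ctx i)) (hardyR i) =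
      Finsupp.mapDomain (resFun (Set.inter_subset_right : Ctx i ∩ Ctx j ⊆ Ctx j)) (hardyR j) := by
  intro i j
  rcases lt_trichotomy i j with hij | rfl | hij
  · exact hardyR_compatible_of_lt hij
  · rfl
  · exact mapDomain_resFun_eq_of_eq (Set.inter_comm _ _) (hardyR_compatible_of_lt hij).symm
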